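/- Let Ω ⊂ ℝⁿ be a compact convex domain with smooth boundary, α : ∂Ω → ℝ smooth, and let u : closure(Ω) × [0,T) → ℝ be a smooth solution of graphical spacelike mean curvature flow with α-Neumann boundary condition. Then for all (x,t) ∈ closure(Ω) × [0,T), |u_t(x,t)| ≤ C_H, where C_H := sup_{x∈Ω} |u_t(x,0)| = sup_{x∈Ω} |√(1−|Du₀|²) Σᵢ Dᵢ(Dᵢu₀/√(1−|Du₀|²))| is determined by the initial datum u₀ = u(·,0). (Equivalently, H² ≤ C_H² v² along the flow, where H is the mean curvature and v = 1/√(1−|Du|²).) -/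

import Mathlib

open Set

noncomputable section

/-- The `i`-th spatial partial derivative (within `closure Ω`) of `u(·,t)`,
i.e. `Dᵢu(x,t)`. -/
def spGrad {n : ℕ} (Ω : Set (Fin n → ℝ)) (u : (Fin n → ℝ) → ℝ → ℝ)
    (x : Fin n → ℝ) (t : ℝ) (i : Fin n) : ℝ :=
  fderivWithin ℝ (fun y => u y t) (closure Ω) x (Pi.single i 1)

/-- `|Du(x,t)|²`. -/
def spGradSq {n : ℕ} (Ω : Set (Fin n → ℝ)) (u : (Fin n → ℝ) → ℝ → ℝ)
    (x : Fin n → ℝ) (t : ℝ) : ℝ :=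
  ∑ i, (spGrad Ω u x t i) ^ 2

/-- `u` is a smooth solution of graphical spacelike mean curvature flow on
`closure Ω × J` with `α`-Neumann boundary condition, where `γ` is the outward
unit normal of `∂Ω`:  `|Du| < 1` (spacelike),
`u_t = √(1-|Du|²) ∑ᵢ Dᵢ(Dᵢu/√(1-|Du|²))` on `Ω × J`, and
`γ·Du = α √(1-|Du|²)` on `∂Ω × J`. -/
structure IsGraphMCF {n : ℕ} (Ω : Set (Fin n → ℝ)) (γ : (Fin n → ℝ) → Fin n → ℝ)
    (α : (Fin n → ℝ) → ℝ) (J : Set ℝ) (u : (Fin n → ℝ) → ℝ → ℝ) : Prop where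
  smooth : ContDiffOn ℝ (⊤ : ℕ∞) (fun q : (Fin n → ℝ) × ℝ => u q.1 q.2) ((closure Ω) ×ˢ J)
  spacelike : ∀ x ∈ closure Ω, ∀ t ∈ J, spGradSq Ω u x t < 1
  pde : ∀ x ∈ Ω, ∀ t ∈ J,
      derivWithin (fun s => u x s) J t =
        Real.sqrt (1 - spGradSq Ω u x t) *
          ∑ i, fderivWithin ℝ
            (fun y => spGrad Ω u y t i / Real.sqrt (1 - spGradSq Ω u y t))
            (closure Ω) x (Pi.single i 1)
  neumann : ∀ x ∈ frontier Ω, ∀ t ∈ J,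
      (∑ i, γ x i * spGrad Ω u x t i) = α x * Real.sqrt (1 - spGradSq Ω u x t)

open scoped ContDiff

/-- The directional derivative within `S` of `G` in the direction `v`. -/
def dirDeriv {V : Type*} [NormedAddCommGroup V] [NormedSpace ℝ V] (S : Set V) (G : V → ℝ)
    (v : V) (z : V) : ℝ :=
  fderivWithin ℝ G S z v

section DirDeriv

variable {V : Type*} [NormedAddCommGroup V] [NormedSpace ℝ V] {S : Set V}

theorem contDiffOn_dirDeriv (hS : UniqueDiffOn ℝ S) {G : V → ℝ} (hG : ContDiffOn ℝ ∞ G S)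
    (v : V) : ContDiffOn ℝ ∞ (dirDeriv S G v) S :=
  (hG.fderivWithin hS (m := ∞) (by simp)).clm_apply contDiffOn_const

theorem dirDeriv_congr {G G' : V → ℝ} (h : EqOn G G' S) (v : V) {z : V} (hz : z ∈ S) :
    dirDeriv S G v z = dirDeriv S G' v z := by
  unfold dirDeriv
  rw [fderivWithin_congr h (h hz)]

theorem dirDeriv_dirDeriv (hS : UniqueDiffOn ℝ S) {G : V → ℝ} (hG : ContDiffOn ℝ ∞ G S)
    (v v' : V) {z : V} (hz : z ∈ S) :
    dirDeriv S (dirDeriv S G v) v' z = fderivWithin ℝ (fderivWithin ℝ G S) S z v' v := by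
  have h1 : DifferentiableWithinAt ℝ (fderivWithin ℝ G S) S z :=
    (hG.fderivWithin hS (m := ∞) (by simp)).differentiableOn (by simp) z hz
  have h2 := (h1.hasFDerivWithinAt.clm_apply (hasFDerivWithinAt_const v z S)).fderivWithin (hS z hz)
  change fderivWithin ℝ (fun y => fderivWithin ℝ G S y v) S z v' = _
  rw [h2]
  simp

theorem dirDeriv_comm (hS : UniqueDiffOn ℝ S) (hS' : S ⊆ closure (interior S)) {G : V → ℝ}
    (hG : ContDiffOn ℝ ∞ G S) (v v' : V) {z : V} (hz : z ∈ S) :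
    dirDeriv S (dirDeriv S G v) v' z = dirDeriv S (dirDeriv S G v') v z := by
  rw [dirDeriv_dirDeriv hS hG v v' hz, dirDeriv_dirDeriv hS hG v' v hz]
  have := (hG z hz).isSymmSndFDerivWithinAt
    (by simpa using WithTop.coe_le_coe.2 (le_top (a := (2 : ℕ∞)))) hS (hS' hz) hz
  exact this v' v

theorem dirDeriv_mul (hS : UniqueDiffOn ℝ S) {f g : V → ℝ} (v : V) {z : V} (hz : z ∈ S)
    (hf : DifferentiableOn ℝ f S) (hg : DifferentiableOn ℝ g S) :
    dirDeriv S (fun y => f y * g y) v z = f z * dirDeriv S g v z + g z * dirDeriv S f v z := by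
  unfold dirDeriv
  rw [fderivWithin_fun_mul (hS z hz) (hf z hz) (hg z hz)]
  simp

theorem dirDeriv_add (hS : UniqueDiffOn ℝ S) {f g : V → ℝ} (v : V) {z : V} (hz : z ∈ S)
    (hf : DifferentiableOn ℝ f S) (hg : DifferentiableOn ℝ g S) :
    dirDeriv S (fun y => f y + g y) v z = dirDeriv S f v z + dirDeriv S g v z := by
  unfold dirDeriv
  rw [fderivWithin_fun_add (hS z hz) (hf z hz) (hg z hz)]
  simp

theorem dirDeriv_sum (hS : UniqueDiffOn ℝ S) {ι : Type*} [Fintype ι] {f : ι → V → ℝ} (v : V)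
    {z : V} (hz : z ∈ S) (hf : ∀ i, DifferentiableOn ℝ (f i) S) :
    dirDeriv S (fun y => ∑ i, f i y) v z = ∑ i, dirDeriv S (f i) v z := by
  unfold dirDeriv
  rw [fderivWithin_fun_sum (hS z hz) (fun i _ => hf i z hz)]
  simp

theorem dirDeriv_const_mul (hS : UniqueDiffOn ℝ S) {f : V → ℝ} (c : ℝ) (v : V)
    {z : V} (hz : z ∈ S) (hf : DifferentiableOn ℝ f S) :
    dirDeriv S (fun y => c * f y) v z = c * dirDeriv S f v z := by
  unfold dirDeriv
  rw [fderivWithin_const_mul (hS z hz) (hf z hz)]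
  simp

theorem dirDeriv_neg (hS : UniqueDiffOn ℝ S) (f : V → ℝ) (v : V) {z : V} (hz : z ∈ S) :
    dirDeriv S (fun y => -f y) v z = -dirDeriv S f v z := by
  unfold dirDeriv
  rw [fderivWithin_fun_neg (hS z hz)]
  simp

theorem dirDeriv_comp (hS : UniqueDiffOn ℝ S) {f : V → ℝ} (v : V) {z : V} (hz : z ∈ S)
    (hf : DifferentiableOn ℝ f S) {φ : ℝ → ℝ} {φ' : ℝ} (hφ : HasDerivAt φ φ' (f z)) :
    dirDeriv S (fun y => φ (f y)) v z = φ' * dirDeriv S f v z := by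
  unfold dirDeriv
  have h := (hφ.comp_hasFDerivWithinAt z (hf z hz).hasFDerivWithinAt).fderivWithin (hS z hz)
  change fderivWithin ℝ (φ ∘ f) S z v = _
  rw [h]
  simp

theorem hasDerivWithinAt_dirDeriv {G : V → ℝ} (hG : DifferentiableOn ℝ G S) {z v : V} {I : Set ℝ}
    (hI : ∀ s ∈ I, z + s • v ∈ S) {s : ℝ} (hs : s ∈ I) :
    HasDerivWithinAt (fun s => G (z + s • v)) (dirDeriv S G v (z + s • v)) I s := by
  have h1 : HasDerivWithinAt (fun s : ℝ => z + s • v) v I s := by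
    simpa using (((hasDerivAt_id s).smul_const v).const_add z).hasDerivWithinAt
  exact (hG _ (hI s hs)).hasFDerivWithinAt.comp_hasDerivWithinAt s h1 hI

end DirDeriv

section OneVariable

theorem deriv_nonpos_of_max_left {f : ℝ → ℝ} {f' a : ℝ} (ha : 0 < a)
    (hf : HasDerivWithinAt f f' (Icc 0 a) 0) (hmax : ∀ s ∈ Icc 0 a, f s ≤ f 0) : f' ≤ 0 := by
  have h := hf.mono_of_mem_nhdsWithin (s := Ioi 0) (Icc_mem_nhdsGT ha)
  rw [hasDerivWithinAt_iff_tendsto_slope' self_notMem_Ioi] at h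
  refine le_of_tendsto h ?_
  filter_upwards [Ioc_mem_nhdsGT ha] with s hs
  rw [slope_def_field, sub_zero]
  exact div_nonpos_of_nonpos_of_nonneg (sub_nonpos.2 (hmax s ⟨hs.1.le, hs.2⟩)) hs.1.le

theorem second_deriv_nonpos_of_max_left {f g : ℝ → ℝ} {g' a : ℝ} (ha : 0 < a)
    (hf : ∀ s ∈ Icc 0 a, HasDerivWithinAt f (g s) (Icc 0 a) s) (hg0 : g 0 = 0)
    (hg : HasDerivWithinAt g g' (Icc 0 a) 0) (hmax : ∀ s ∈ Icc 0 a, f s ≤ f 0) : g' ≤ 0 := by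
  by_contra! hpos
  have h := hg.mono_of_mem_nhdsWithin (s := Ioi 0) (Icc_mem_nhdsGT ha)
  rw [hasDerivWithinAt_iff_tendsto_slope' self_notMem_Ioi] at h
  have h1 := (h.eventually (lt_mem_nhds hpos)).and (Ioc_mem_nhdsGT ha)
  obtain ⟨b, hb, hb'⟩ := (mem_nhdsGT_iff_exists_Ioc_subset).1 h1
  have hb : 0 < b := hb
  have hba : b ≤ a := (hb' ⟨hb, le_rfl⟩).2.2
  obtain ⟨c, hc, hc'⟩ := exists_hasDerivAt_eq_slope f g hb
    (fun s hs => ((hf s ⟨hs.1, hs.2.trans hba⟩).continuousWithinAt).mono (Icc_subset_Icc_right hba))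
    (fun s hs => (hf s ⟨hs.1.le, hs.2.le.trans hba⟩).hasDerivAt
      (Icc_mem_nhds hs.1 (hs.2.trans_le hba)))
  have h2 := (hb' ⟨hc.1, hc.2.le⟩).1
  simp only [slope_def_field, hg0, sub_zero] at h2
  have h3 : 0 < g c := by
    rcases div_pos_iff.1 h2 with h | h
    · exact h.1
    · exact absurd h.2 (not_lt.2 hc.1.le)
  have h4 : g c ≤ 0 := by
    rw [hc']
    exact div_nonpos_of_nonpos_of_nonneg (sub_nonpos.2 (hmax b ⟨hb.le, hba⟩)) (by linarith)
  linarith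

end OneVariable

section Convex

variable {n : ℕ} {Ω : Set (Fin n → ℝ)} {γ : (Fin n → ℝ) → Fin n → ℝ}

/-- A convex open set with continuous outward normal `γ` has the open half space
`{v | γ x · v < 0}` as its cone of inward directions at the boundary point `x`. -/
theorem exists_add_smul_mem_of_normal_neg (hΩo : IsOpen Ω)
    (hγout : ∀ x ∈ frontier Ω, ∀ y ∈ Ω, ∑ i, γ x i * (y i - x i) ≤ 0)
    (hγc : ContinuousOn γ (frontier Ω)) {x : Fin n → ℝ} (hx : x ∈ frontier Ω) {v : Fin n → ℝ}
    (hv : ∑ i, γ x i * v i < 0) : ∃ s : ℝ, 0 < s ∧ x + s • v ∈ Ω := by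
  by_contra! hout
  have hcont : ContinuousWithinAt (fun y => ∑ i, γ y i * v i) (frontier Ω) x := by
    have := hγc x hx
    refine tendsto_finsetSum _ fun i _ => ?_
    exact (((continuous_apply i).tendsto _).comp this).mul_const _
  have hev := hcont.eventually (gt_mem_nhds hv)
  rw [eventually_nhdsWithin_iff, Metric.eventually_nhds_iff_ball] at hev
  obtain ⟨δ, hδ, hball⟩ := hev
  have hxcl : x ∈ closure Ω := hx.1
  obtain ⟨p, hpΩ, hpx⟩ := Metric.mem_closure_iff.1 hxcl δ hδ
  have hpb : p ∈ Metric.ball x δ := by rwa [Metric.mem_ball, dist_comm]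
  obtain ⟨s, hs, hsb⟩ : ∃ s : ℝ, 0 < s ∧ x + s • v ∈ Metric.ball x δ := by
    have hc : Filter.Tendsto (fun s : ℝ => x + s • v) (nhdsWithin 0 (Ioi 0)) (nhds x) := by
      have : Continuous (fun s : ℝ => x + s • v) := by fun_prop
      have h := this.tendsto 0
      simp only [zero_smul, add_zero] at h
      exact h.mono_left nhdsWithin_le_nhds
    have h1 := (hc.eventually (Metric.ball_mem_nhds x hδ)).and self_mem_nhdsWithin
    obtain ⟨s, h2, h3⟩ := h1.exists
    exact ⟨s, h3, h2⟩
  have hqΩ := hout s hs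
  obtain ⟨y, hyseg, hyfr⟩ : (segment ℝ p (x + s • v) ∩ frontier Ω).Nonempty := by
    by_contra hempty
    have hsub : segment ℝ p (x + s • v) ⊆ Ω ∪ (closure Ω)ᶜ := by
      intro y hy
      by_contra hn
      simp only [mem_union, mem_compl_iff, not_or, not_not] at hn
      exact hempty ⟨y, hy, hΩo.frontier_eq ▸ ⟨hn.2, hn.1⟩⟩
    have hq := hsub (right_mem_segment ℝ _ _)
    obtain ⟨y, -, h1, h2⟩ := (convex_segment (𝕜 := ℝ) p (x + s • v)).isPreconnected _ _ hΩo
      isClosed_closure.isOpen_compl hsub ⟨p, left_mem_segment ℝ _ _, hpΩ⟩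
      ⟨_, right_mem_segment ℝ _ _, hq.resolve_left hqΩ⟩
    exact h2 (subset_closure h1)
  have hyb : y ∈ Metric.ball x δ := (convex_ball x δ).segment_subset hpb hsb hyseg
  have hlt := hball y hyb hyfr
  have hyΩ : y ∉ Ω := by
    rw [hΩo.frontier_eq] at hyfr
    exact hyfr.2
  have hpy := hγout y hyfr p hpΩ
  have hxy : ∑ i, γ y i * (x i - y i) ≤ 0 := by
    have hcl : IsClosed {z : Fin n → ℝ | ∑ i, γ y i * (z i - y i) ≤ 0} :=
      isClosed_le (by fun_prop) continuous_const
    exact closure_minimal (fun z hz => hγout y hyfr z hz) hcl hxcl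
  obtain ⟨a, b, ha, hb, hab, rfl⟩ := hyseg
  set y := a • p + b • (x + s • v) with hy
  have hb0 : 0 < b := by
    rcases hb.eq_or_lt with h | h
    · exfalso
      apply hyΩ
      have : a = 1 := by linarith
      simpa [hy, ← h, this] using hpΩ
    · exact h
  have key : a * ∑ i, γ y i * (p i - y i) + b * ∑ i, γ y i * (x i - y i)
      + b * s * ∑ i, γ y i * v i = 0 := by
    simp only [Finset.mul_sum, ← Finset.sum_add_distrib]
    refine Finset.sum_eq_zero fun i _ => ?_
    have : y i = a * p i + b * (x i + s * v i) := by simp [hy, mul_add]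
    have h1 : a * p i + b * x i + b * s * v i - (a + b) * y i = 0 := by rw [hab, this]; ring
    linear_combination (γ y i) * h1
  have h1 := mul_nonpos_of_nonneg_of_nonpos ha hpy
  have h2 := mul_nonpos_of_nonneg_of_nonpos hb hxy
  have h3 := mul_neg_of_pos_of_neg (mul_pos hb0 hs) hlt
  linarith

end Convex

section MaximumPrinciple

theorem subset_closure_interior_of_convex {V : Type*} [NormedAddCommGroup V] [NormedSpace ℝ V]
    {S : Set V} (hS : Convex ℝ S) (hS' : (interior S).Nonempty) : S ⊆ closure (interior S) :=
  hS.closure_interior_eq_closure_of_nonempty_interior hS' ▸ subset_closure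

variable {n : ℕ} {Ω : Set (Fin n → ℝ)} {T : ℝ}

theorem convex_closure_prod_Ico (hΩconv : Convex ℝ Ω) :
    Convex ℝ (closure Ω ×ˢ Ico (0 : ℝ) T) :=
  hΩconv.closure.prod (convex_Ico 0 T)

theorem interior_closure_prod_Ico_nonempty (hΩo : IsOpen Ω) (hΩne : Ω.Nonempty) (hT : 0 < T) :
    (interior (closure Ω ×ˢ Ico (0 : ℝ) T)).Nonempty := by
  obtain ⟨x, hx⟩ := hΩne
  refine ⟨(x, T / 2), ?_⟩
  rw [interior_prod_eq, interior_Ico]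
  exact ⟨interior_maximal subset_closure hΩo hx, by simp; linarith, by simp; linarith⟩

theorem uniqueDiffOn_closure_prod_Ico (hΩo : IsOpen Ω) (hΩconv : Convex ℝ Ω) (hΩne : Ω.Nonempty)
    (hT : 0 < T) : UniqueDiffOn ℝ (closure Ω ×ˢ Ico (0 : ℝ) T) :=
  uniqueDiffOn_convex (convex_closure_prod_Ico hΩconv)
    (interior_closure_prod_Ico_nonempty hΩo hΩne hT)

/-- Along directions pointing into `Ω`, a function with a spatial maximum has nonpositive first
derivative, and nonpositive second derivative if the first one vanishes. -/
theorem dirDeriv_nonpos_of_max_of_mem (hΩo : IsOpen Ω) (hΩconv : Convex ℝ Ω) (hΩne : Ω.Nonempty)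
    (hT : 0 < T) {w : (Fin n → ℝ) × ℝ → ℝ}
    (hw : ContDiffOn ℝ ∞ w (closure Ω ×ˢ Ico (0 : ℝ) T))
    {x : Fin n → ℝ} {t : ℝ} (hx : x ∈ closure Ω) (ht : t ∈ Ico (0 : ℝ) T)
    (hmax : ∀ y ∈ closure Ω, w (y, t) ≤ w (x, t)) {v : Fin n → ℝ} {s : ℝ} (hs : 0 < s)
    (hv : x + s • v ∈ Ω) :
    dirDeriv (closure Ω ×ˢ Ico (0 : ℝ) T) w (v, 0) (x, t) ≤ 0 ∧
    (dirDeriv (closure Ω ×ˢ Ico (0 : ℝ) T) w (v, 0) (x, t) = 0 →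
      dirDeriv (closure Ω ×ˢ Ico (0 : ℝ) T)
        (dirDeriv (closure Ω ×ˢ Ico (0 : ℝ) T) w (v, 0)) (v, 0) (x, t) ≤ 0) := by
  set D := closure Ω ×ˢ Ico (0 : ℝ) T with hD
  have hDu : UniqueDiffOn ℝ D := uniqueDiffOn_closure_prod_Ico hΩo hΩconv hΩne hT
  have hI' : ∀ r ∈ Icc 0 s, x + r • v ∈ closure Ω := by
    intro r hr
    have h := hΩconv.closure.add_smul_mem (t := r / s) hx
      (by exact subset_closure hv) ⟨div_nonneg hr.1 hs.le, (div_le_one hs).2 hr.2⟩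
    rwa [smul_smul, div_mul_cancel₀ _ hs.ne'] at h
  have hI : ∀ r ∈ Icc 0 s, ((x, t) : (Fin n → ℝ) × ℝ) + r • ((v, 0) : (Fin n → ℝ) × ℝ) ∈ D := by
    intro r hr
    have := hI' r hr
    simp only [Prod.smul_mk, smul_zero, Prod.mk_add_mk, add_zero]
    exact ⟨this, ht⟩
  have h0 : (0 : ℝ) ∈ Icc 0 s := ⟨le_rfl, hs.le⟩
  have hf := fun r hr => hasDerivWithinAt_dirDeriv (hw.differentiableOn (by simp)) hI (s := r) hr
  have hg := hasDerivWithinAt_dirDeriv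
    ((contDiffOn_dirDeriv hDu hw (v, 0)).differentiableOn (by simp)) hI h0
  have hm : ∀ r ∈ Icc 0 s, w ((x, t) + r • (v, 0)) ≤ w ((x, t) + (0 : ℝ) • (v, 0)) := by
    intro r hr
    simpa using hmax _ (hI' r hr)
  refine ⟨?_, fun hz => ?_⟩
  · simpa using deriv_nonpos_of_max_left hs (hf 0 h0) hm
  · simpa using second_deriv_nonpos_of_max_left hs hf (by simpa using hz) hg hm

/-- Spatial first and second order conditions at a maximum satisfying an oblique boundary
condition; no barrier is needed since `w` is smooth up to the boundary. -/
theorem dirDeriv_eq_zero_and_nonpos_of_max (hΩo : IsOpen Ω) (hΩconv : Convex ℝ Ω)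
    (hΩne : Ω.Nonempty) {γ : (Fin n → ℝ) → Fin n → ℝ}
    (hγout : ∀ x ∈ frontier Ω, ∀ y ∈ Ω, ∑ i, γ x i * (y i - x i) ≤ 0)
    (hγc : ContinuousOn γ (frontier Ω))
    (hT : 0 < T) {w : (Fin n → ℝ) × ℝ → ℝ}
    (hw : ContDiffOn ℝ ∞ w (closure Ω ×ˢ Ico (0 : ℝ) T))
    {x : Fin n → ℝ} {t : ℝ} (hx : x ∈ closure Ω) (ht : t ∈ Ico (0 : ℝ) T)
    (hbd : x ∈ frontier Ω → ∃ β : Fin n → ℝ, 0 < ∑ i, γ x i * β i ∧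
      dirDeriv (closure Ω ×ˢ Ico (0 : ℝ) T) w (β, 0) (x, t) = 0)
    (hmax : ∀ y ∈ closure Ω, w (y, t) ≤ w (x, t)) :
    (∀ v, dirDeriv (closure Ω ×ˢ Ico (0 : ℝ) T) w (v, 0) (x, t) = 0) ∧
    ∀ v, dirDeriv (closure Ω ×ˢ Ico (0 : ℝ) T)
        (dirDeriv (closure Ω ×ˢ Ico (0 : ℝ) T) w (v, 0)) (v, 0) (x, t) ≤ 0 := by
  have hin := fun (v : Fin n → ℝ) (s : ℝ) (hs : 0 < s) =>
    dirDeriv_nonpos_of_max_of_mem hΩo hΩconv hΩne hT hw hx ht hmax (v := v) hs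
  set D := closure Ω ×ˢ Ico (0 : ℝ) T with hD
  have hDu : UniqueDiffOn ℝ D := uniqueDiffOn_closure_prod_Ico hΩo hΩconv hΩne hT
  have hz : (x, t) ∈ D := ⟨hx, ht⟩
  simp only [dirDeriv_dirDeriv hDu hw _ _ hz] at hin ⊢
  unfold dirDeriv at hin hbd ⊢
  set L := fderivWithin ℝ w D (x, t)
  set A := fderivWithin ℝ (fderivWithin ℝ w D) D (x, t)
  by_cases hxΩ : x ∈ Ω
  · have hall : ∀ v : Fin n → ℝ, ∃ s : ℝ, 0 < s ∧ x + s • v ∈ Ω := by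
      intro v
      have hc : Filter.Tendsto (fun s : ℝ => x + s • v) (nhdsWithin 0 (Ioi 0)) (nhds x) := by
        have : Continuous (fun s : ℝ => x + s • v) := by fun_prop
        have h := this.tendsto 0
        simp only [zero_smul, add_zero] at h
        exact h.mono_left nhdsWithin_le_nhds
      obtain ⟨s, h2, h3⟩ := ((hc.eventually (hΩo.mem_nhds hxΩ)).and self_mem_nhdsWithin).exists
      exact ⟨s, h3, h2⟩
    have h1 : ∀ v : Fin n → ℝ, L (v, 0) ≤ 0 := fun v => by
      obtain ⟨s, hs, hv⟩ := hall v
      exact (hin v s hs hv).1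
    have h2 : ∀ v : Fin n → ℝ, L (v, 0) = 0 := fun v => by
      refine le_antisymm (h1 v) ?_
      have h := h1 (-v)
      rw [show ((-v, 0) : (Fin n → ℝ) × ℝ) = -(v, 0) by simp, map_neg] at h
      linarith
    refine ⟨h2, fun v => ?_⟩
    obtain ⟨s, hs, hv⟩ := hall v
    exact (hin v s hs hv).2 (h2 v)
  · have hxf : x ∈ frontier Ω := hΩo.frontier_eq ▸ ⟨hx, hxΩ⟩
    obtain ⟨β, hβ, hLβ⟩ := hbd hxf
    have hall := fun (v : Fin n → ℝ) (hv : ∑ i, γ x i * v i < 0) =>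
      exists_add_smul_mem_of_normal_neg hΩo hγout hγc hxf hv
    have hlin : ∀ (v : Fin n → ℝ) (M : ℝ),
        ∑ i, γ x i * (v - M • β) i = ∑ i, γ x i * v i - M * ∑ i, γ x i * β i := by
      intro v M
      rw [Finset.mul_sum, ← Finset.sum_sub_distrib]
      refine Finset.sum_congr rfl fun i _ => ?_
      simp only [Pi.sub_apply, Pi.smul_apply, smul_eq_mul]
      ring
    have hpair : ∀ (v : Fin n → ℝ) (M : ℝ),
        ((v - M • β, 0) : (Fin n → ℝ) × ℝ) = (v, 0) - M • (β, 0) := by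
      intro v M
      simp
    have h1 : ∀ v : Fin n → ℝ, L (v, 0) ≤ 0 := by
      intro v
      set M := (∑ i, γ x i * v i + 1) / ∑ i, γ x i * β i with hM
      have hneg : ∑ i, γ x i * (v - M • β) i < 0 := by
        rw [hlin, hM, div_mul_cancel₀ _ hβ.ne']
        linarith
      obtain ⟨s, hs, hv⟩ := hall _ hneg
      have h := (hin _ s hs hv).1
      rw [hpair, map_sub, map_smul, hLβ] at h
      simpa using h
    have h2 : ∀ v : Fin n → ℝ, L (v, 0) = 0 := fun v => by
      refine le_antisymm (h1 v) ?_
      have h := h1 (-v)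
      rw [show ((-v, 0) : (Fin n → ℝ) × ℝ) = -(v, 0) by simp, map_neg] at h
      linarith
    refine ⟨h2, ?_⟩
    have h3 : ∀ v : Fin n → ℝ, ∑ i, γ x i * v i < 0 → A (v, 0) (v, 0) ≤ 0 := by
      intro v hv
      obtain ⟨s, hs, hv⟩ := hall v hv
      exact (hin v s hs hv).2 (h2 v)
    have h4 : ∀ v : Fin n → ℝ, ∑ i, γ x i * v i ≤ 0 → A (v, 0) (v, 0) ≤ 0 := by
      intro v hv
      have hc : Continuous fun ε : ℝ => A ((v, 0) - ε • (β, 0)) ((v, 0) - ε • (β, 0)) := by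
        fun_prop
      have hlim := (hc.tendsto 0).mono_left (nhdsWithin_le_nhds (s := Ioi 0))
      simp only [zero_smul, sub_zero] at hlim
      refine le_of_tendsto hlim ?_
      filter_upwards [self_mem_nhdsWithin] with ε hε
      rw [← hpair]
      refine h3 _ ?_
      rw [hlin]
      have := mul_pos (show 0 < ε from hε) hβ
      linarith
    intro v
    rcases le_total (∑ i, γ x i * v i) 0 with h | h
    · exact h4 v h
    · have h5 := h4 (-v) (by simpa using h)
      rw [show ((-v, 0) : (Fin n → ℝ) × ℝ) = -(v, 0) by simp, map_neg, map_neg,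
        neg_apply, neg_neg] at h5
      exact h5

/-- The maximum principle for parabolic equations whose gradient-free part is a nonnegative
combination of second derivatives, with an oblique boundary condition. -/
theorem le_of_parabolic_of_oblique (hΩo : IsOpen Ω) (hΩconv : Convex ℝ Ω)
    (hΩbd : Bornology.IsBounded Ω) (hΩne : Ω.Nonempty) {γ : (Fin n → ℝ) → Fin n → ℝ}
    (hγout : ∀ x ∈ frontier Ω, ∀ y ∈ Ω, ∑ i, γ x i * (y i - x i) ≤ 0)
    (hγc : ContinuousOn γ (frontier Ω)) (hT : 0 < T) {D : Set ((Fin n → ℝ) × ℝ)}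
    (hD : D = closure Ω ×ˢ Ico (0 : ℝ) T) {w : (Fin n → ℝ) × ℝ → ℝ}
    (hw : ContDiffOn ℝ ∞ w D) {C : ℝ}
    (hpde : ∀ z ∈ D, (∀ v, dirDeriv D w (v, 0) z = 0) → ∃ c : ℝ, 0 ≤ c ∧ ∃ p : Fin n → ℝ,
      dirDeriv D w (0, 1) z =
        ∑ i, dirDeriv D (dirDeriv D w (Pi.single i 1, 0)) (Pi.single i 1, 0) z +
          c * dirDeriv D (dirDeriv D w (p, 0)) (p, 0) z)
    (hbd : ∀ x ∈ frontier Ω, ∀ t ∈ Ico (0 : ℝ) T, ∃ β : Fin n → ℝ, 0 < ∑ i, γ x i * β i ∧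
      dirDeriv D w (β, 0) (x, t) = 0)
    (h0 : ∀ x ∈ closure Ω, w (x, 0) ≤ C) : ∀ z ∈ D, w z ≤ C := by
  subst hD
  by_contra! hcon
  obtain ⟨⟨x₁, t₁⟩, ⟨hx₁, ht₁⟩, hz₁⟩ := hcon
  simp only at hx₁ ht₁
  set ε := (w (x₁, t₁) - C) / (t₁ + 1) with hε
  have ht₁' : 0 < t₁ + 1 := by linarith [ht₁.1]
  have hεpos : 0 < ε := div_pos (by linarith) ht₁'
  have hεmul : ε * (t₁ + 1) = w (x₁, t₁) - C := div_mul_cancel₀ _ ht₁'.ne'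
  have hsub : closure Ω ×ˢ Icc 0 t₁ ⊆ closure Ω ×ˢ Ico (0 : ℝ) T :=
    prod_mono_right (Icc_subset_Ico_right ht₁.2)
  have hcomp : IsCompact (closure Ω ×ˢ Icc 0 t₁) :=
    hΩbd.isCompact_closure.prod isCompact_Icc
  obtain ⟨⟨x, t⟩, ⟨hx, ht⟩, hmax⟩ := hcomp.exists_isMaxOn
    ⟨(x₁, t₁), hx₁, ht₁.1, le_rfl⟩ (f := fun z => w z - ε * z.2)
    ((hw.continuousOn.mono hsub).sub (by fun_prop))
  simp only at hx ht
  have hmax' : ∀ y ∈ closure Ω, ∀ s ∈ Icc 0 t₁, w (y, s) - ε * s ≤ w (x, t) - ε * t :=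
    fun y hy s hs => hmax (show (y, s) ∈ closure Ω ×ˢ Icc 0 t₁ from ⟨hy, hs⟩)
  have htT : t ∈ Ico 0 T := ⟨ht.1, ht.2.trans_lt ht₁.2⟩
  have ht0 : 0 < t := by
    rcases ht.1.eq_or_lt with h | h
    · exfalso
      have h1 := hmax' x₁ hx₁ t₁ ⟨ht₁.1, le_rfl⟩
      have h2 := h0 x hx
      rw [← h] at h1
      linarith
    · exact h
  obtain ⟨hL, hA⟩ := dirDeriv_eq_zero_and_nonpos_of_max hΩo hΩconv hΩne hγout hγc hT hw hx htT
    (fun hxf => hbd x hxf t htT) (fun y hy => by linarith [hmax' y hy t ht])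
  obtain ⟨c, hc, p, hp⟩ := hpde (x, t) ⟨hx, htT⟩ hL
  have hle : dirDeriv (closure Ω ×ˢ Ico (0 : ℝ) T) w (0, 1) (x, t) ≤ 0 := by
    rw [hp]
    have h1 := Finset.sum_nonpos fun (i : Fin n) (_ : i ∈ Finset.univ) => hA (Pi.single i 1)
    have h2 := mul_nonpos_of_nonneg_of_nonpos hc (hA p)
    linarith
  have hI : ∀ r ∈ Icc 0 t, ((x, t) : (Fin n → ℝ) × ℝ) + r • ((0, -1) : (Fin n → ℝ) × ℝ) ∈
      closure Ω ×ˢ Ico (0 : ℝ) T := by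
    intro r hr
    simp only [Prod.smul_mk, smul_zero, Prod.mk_add_mk, add_zero, smul_eq_mul]
    exact ⟨hx, by linarith [hr.2], by linarith [hr.1, htT.2]⟩
  have hder := (hasDerivWithinAt_dirDeriv (hw.differentiableOn (by simp)) hI
    (s := 0) ⟨le_rfl, ht0.le⟩).add
    (((hasDerivAt_id (0 : ℝ)).const_mul ε).hasDerivWithinAt (s := Icc 0 t))
  have h := deriv_nonpos_of_max_left ht0 hder (by
    intro r hr
    have := hmax' x hx (t - r) ⟨by linarith [hr.2], by linarith [hr.1, ht.2]⟩
    simp only [Pi.add_apply, Prod.smul_mk, smul_zero, Prod.mk_add_mk, add_zero, smul_eq_mul, id,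
      mul_zero, mul_neg, mul_one, ← sub_eq_add_neg, sub_zero]
    linarith)
  have hneg : dirDeriv (closure Ω ×ˢ Ico (0 : ℝ) T) w (0, -1) (x, t) =
      -dirDeriv (closure Ω ×ˢ Ico (0 : ℝ) T) w (0, 1) (x, t) := by
    unfold dirDeriv
    rw [← map_neg]
    simp
  rw [zero_smul, add_zero, hneg] at h
  linarith

end MaximumPrinciple

section Linearization

variable {V : Type*} [NormedAddCommGroup V] [NormedSpace ℝ V] {S : Set V} {n : ℕ}

/-- The gradient function `v = 1 / √(1 - |DF|²)`, with `DF` taken in the directions `e i`. -/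
def tilt (S : Set V) (F : V → ℝ) (e : Fin n → V) (z : V) : ℝ :=
  (√(1 - ∑ i, dirDeriv S F (e i) z ^ 2))⁻¹

variable {F : V → ℝ} {e : Fin n → V}

theorem contDiffOn_sqrt_one_sub_gradSq (hS : UniqueDiffOn ℝ S) (hF : ContDiffOn ℝ ∞ F S)
    (hsp : ∀ z ∈ S, ∑ i, dirDeriv S F (e i) z ^ 2 < 1) :
    ContDiffOn ℝ ∞ (fun z => √(1 - ∑ i, dirDeriv S F (e i) z ^ 2)) S :=
  (contDiffOn_const.sub (ContDiffOn.sum fun i _ => (contDiffOn_dirDeriv hS hF (e i)).pow 2)).sqrt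
    fun z hz => (sub_pos.2 (hsp z hz)).ne'

theorem contDiffOn_tilt (hS : UniqueDiffOn ℝ S) (hF : ContDiffOn ℝ ∞ F S)
    (hsp : ∀ z ∈ S, ∑ i, dirDeriv S F (e i) z ^ 2 < 1) :
    ContDiffOn ℝ ∞ (tilt S F e) S :=
  (contDiffOn_sqrt_one_sub_gradSq hS hF hsp).inv
    fun z hz => (Real.sqrt_pos.2 (sub_pos.2 (hsp z hz))).ne'

theorem dirDeriv_sqrt_one_sub_gradSq (hS : UniqueDiffOn ℝ S) (hF : ContDiffOn ℝ ∞ F S)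
    (hsp : ∀ z ∈ S, ∑ i, dirDeriv S F (e i) z ^ 2 < 1) (v : V) {z : V} (hz : z ∈ S) :
    dirDeriv S (fun z => √(1 - ∑ i, dirDeriv S F (e i) z ^ 2)) v z =
      -(tilt S F e z * ∑ k, dirDeriv S F (e k) z * dirDeriv S (dirDeriv S F (e k)) v z) := by
  have hp : ∀ i, ContDiffOn ℝ ∞ (fun z => dirDeriv S F (e i) z) S :=
    fun i => contDiffOn_dirDeriv hS hF (e i)
  have hq : ∀ i, ContDiffOn ℝ ∞ (fun z => dirDeriv S F (e i) z ^ 2) S := fun i => (hp i).pow 2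
  have hpos := sub_pos.2 (hsp z hz)
  have hφ : HasDerivAt (fun y : ℝ => √(1 - y))
      (-1 / (2 * √(1 - ∑ i, dirDeriv S F (e i) z ^ 2))) (∑ i, dirDeriv S F (e i) z ^ 2) := by
    exact ((hasDerivAt_id _).const_sub 1).sqrt hpos.ne'
  rw [dirDeriv_comp hS (f := fun z => ∑ i, dirDeriv S F (e i) z ^ 2) v hz
    ((ContDiffOn.sum fun i _ => hq i).differentiableOn (by simp)) hφ,
    dirDeriv_sum hS v hz fun i => (hq i).differentiableOn (by simp)]
  have hterm : ∀ i, dirDeriv S (fun z => dirDeriv S F (e i) z ^ 2) v z =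
      2 * (dirDeriv S F (e i) z * dirDeriv S (dirDeriv S F (e i)) v z) := by
    intro i
    simp only [pow_two]
    rw [dirDeriv_mul hS v hz ((hp i).differentiableOn (by simp))
      ((hp i).differentiableOn (by simp))]
    ring
  simp only [hterm, ← Finset.mul_sum, tilt]
  have := (Real.sqrt_pos.2 hpos).ne'
  field_simp

theorem dirDeriv_tilt (hS : UniqueDiffOn ℝ S) (hF : ContDiffOn ℝ ∞ F S)
    (hsp : ∀ z ∈ S, ∑ i, dirDeriv S F (e i) z ^ 2 < 1) (v : V) {z : V} (hz : z ∈ S) :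
    dirDeriv S (tilt S F e) v z = tilt S F e z ^ 3 *
      ∑ k, dirDeriv S F (e k) z * dirDeriv S (dirDeriv S F (e k)) v z := by
  have hpos := (Real.sqrt_pos.2 (sub_pos.2 (hsp z hz))).ne'
  have h := dirDeriv_comp hS v hz
    ((contDiffOn_sqrt_one_sub_gradSq hS hF hsp).differentiableOn (by simp)) (hasDerivAt_inv hpos)
  rw [dirDeriv_sqrt_one_sub_gradSq hS hF hsp v hz] at h
  change dirDeriv S (tilt S F e) v z = _ at h
  rw [h, tilt, ← inv_pow]
  ring

/-- Linearization of the flow equation at a point where the gradient of the speed vanishes. -/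
theorem dirDeriv_speed_eq (hS : UniqueDiffOn ℝ S) (hS' : S ⊆ closure (interior S))
    (hF : ContDiffOn ℝ ∞ F S) (hsp : ∀ z ∈ S, ∑ i, dirDeriv S F (e i) z ^ 2 < 1) {τ : V}
    (hpde : ∀ z ∈ S, dirDeriv S F τ z = √(1 - ∑ i, dirDeriv S F (e i) z ^ 2) *
      ∑ i, dirDeriv S (fun y => dirDeriv S F (e i) y * tilt S F e y) (e i) z)
    {z : V} (hz : z ∈ S) (hcrit : ∀ k, dirDeriv S (dirDeriv S F τ) (e k) z = 0) :
    dirDeriv S (dirDeriv S F τ) τ z =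
      ∑ i, dirDeriv S (dirDeriv S (dirDeriv S F τ) (e i)) (e i) z +
        tilt S F e z ^ 2 * ∑ i, ∑ k, dirDeriv S F (e i) z * dirDeriv S F (e k) z *
          dirDeriv S (dirDeriv S (dirDeriv S F τ) (e k)) (e i) z := by
  set w := dirDeriv S F τ with hwdef
  have hw : ContDiffOn ℝ ∞ w S := contDiffOn_dirDeriv hS hF τ
  have hp : ∀ i, ContDiffOn ℝ ∞ (dirDeriv S F (e i)) S := fun i => contDiffOn_dirDeriv hS hF (e i)
  have hwk : ∀ i, ContDiffOn ℝ ∞ (dirDeriv S w (e i)) S := fun i => contDiffOn_dirDeriv hS hw (e i)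
  have hρ : ContDiffOn ℝ ∞ (tilt S F e) S := contDiffOn_tilt hS hF hsp
  have hR := contDiffOn_sqrt_one_sub_gradSq hS hF hsp
  have hQ : ∀ i, ContDiffOn ℝ ∞ (fun y => dirDeriv S F (e i) y * tilt S F e y) S :=
    fun i => (hp i).mul hρ
  have hd : ∀ {f : V → ℝ}, ContDiffOn ℝ ∞ f S → DifferentiableOn ℝ f S :=
    fun h => h.differentiableOn (by simp)
  have hcomm : ∀ k, ∀ y ∈ S, dirDeriv S (dirDeriv S F (e k)) τ y = dirDeriv S w (e k) y :=
    fun k y hy => dirDeriv_comm hS hS' hF (e k) τ hy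
  have hRρ : √(1 - ∑ i, dirDeriv S F (e i) z ^ 2) * tilt S F e z = 1 :=
    mul_inv_cancel₀ (Real.sqrt_pos.2 (sub_pos.2 (hsp z hz))).ne'
  have hQτ : ∀ i, EqOn (dirDeriv S (fun y => dirDeriv S F (e i) y * tilt S F e y) τ)
      (fun y => ∑ k, dirDeriv S F (e i) y * tilt S F e y ^ 3 * dirDeriv S F (e k) y *
        dirDeriv S w (e k) y + tilt S F e y * dirDeriv S w (e i) y) S := by
    intro i y hy
    simp only
    rw [dirDeriv_mul hS τ hy (hd (hp i)) (hd hρ), dirDeriv_tilt hS hF hsp τ hy, hcomm i y hy,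
      ← mul_assoc, Finset.mul_sum]
    congr 1
    refine Finset.sum_congr rfl fun k _ => ?_
    rw [hcomm k y hy]
    ring
  have hmul0 : ∀ {f : V → ℝ} (k i : Fin n), ContDiffOn ℝ ∞ f S →
      dirDeriv S (fun y => f y * dirDeriv S w (e k) y) (e i) z =
        f z * dirDeriv S (dirDeriv S w (e k)) (e i) z := by
    intro f k i hf
    rw [dirDeriv_mul hS _ hz (hd hf) (hd (hwk k)), hcrit k, zero_mul, add_zero]
  have hc : ∀ i k, ContDiffOn ℝ ∞ (fun y => dirDeriv S F (e i) y * tilt S F e y ^ 3 *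
      dirDeriv S F (e k) y) S := fun i k => ((hp i).mul (hρ.pow 3)).mul (hp k)
  have hQτi : ∀ i, dirDeriv S (dirDeriv S (fun y => dirDeriv S F (e i) y * tilt S F e y) (e i)) τ z
      = ∑ k, dirDeriv S F (e i) z * tilt S F e z ^ 3 * dirDeriv S F (e k) z *
        dirDeriv S (dirDeriv S w (e k)) (e i) z +
        tilt S F e z * dirDeriv S (dirDeriv S w (e i)) (e i) z := by
    intro i
    rw [dirDeriv_comm hS hS' (hQ i) (e i) τ hz, dirDeriv_congr (hQτ i) (e i) hz,
      dirDeriv_add hS _ hz (hd (ContDiffOn.sum fun k _ => (hc i k).mul (hwk k)))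
        (hd (hρ.mul (hwk i))),
      dirDeriv_sum hS _ hz (fun k => hd ((hc i k).mul (hwk k))), hmul0 i i hρ]
    congr 1
    exact Finset.sum_congr rfl fun k _ => hmul0 k i (hc i k)
  have hRτ : dirDeriv S (fun z => √(1 - ∑ i, dirDeriv S F (e i) z ^ 2)) τ z = 0 := by
    rw [dirDeriv_sqrt_one_sub_gradSq hS hF hsp τ hz,
      Finset.sum_eq_zero fun k _ => by rw [hcomm k z hz, hcrit k, mul_zero]]
    simp
  rw [dirDeriv_congr (fun y hy => hpde y hy) τ hz, dirDeriv_mul hS τ hz (hd hR)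
    (hd (ContDiffOn.sum fun i _ => contDiffOn_dirDeriv hS (hQ i) (e i))), hRτ, mul_zero, add_zero,
    dirDeriv_sum hS τ hz (fun i => hd (contDiffOn_dirDeriv hS (hQ i) (e i)))]
  simp only [hQτi]
  simp only [Finset.mul_sum, ← Finset.sum_add_distrib, mul_add]
  set R := √(1 - ∑ i, dirDeriv S F (e i) z ^ 2)
  refine Finset.sum_congr rfl fun i _ => ?_
  rw [add_comm]
  congr 1
  · rw [← mul_assoc, hRρ, one_mul]
  · refine Finset.sum_congr rfl fun k _ => ?_
    linear_combination (dirDeriv S F (e i) z * tilt S F e z ^ 2 * dirDeriv S F (e k) z *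
        dirDeriv S (dirDeriv S w (e k)) (e i) z) * hRρ

end Linearization

section Flow

variable {n : ℕ} {Ω : Set (Fin n → ℝ)} {T : ℝ}

theorem fderivWithin_slice_eq_dirDeriv {K : Set (Fin n → ℝ)} {J : Set ℝ}
    (hK : UniqueDiffOn ℝ K) {D : Set ((Fin n → ℝ) × ℝ)} (hD : D = K ×ˢ J)
    {G : (Fin n → ℝ) × ℝ → ℝ} (hG : DifferentiableOn ℝ G D)
    {x : Fin n → ℝ} {t : ℝ} (hx : x ∈ K) (ht : t ∈ J) (v : Fin n → ℝ) :
    fderivWithin ℝ (fun y => G (y, t)) K x v = dirDeriv D G (v, 0) (x, t) := by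
  subst hD
  have h := (hG (x, t) ⟨hx, ht⟩).hasFDerivWithinAt.comp (f := fun y => (y, t)) x
    ((hasFDerivAt_prodMk_left x t).hasFDerivWithinAt (s := K)) (fun y hy => ⟨hy, ht⟩)
  have h2 := h.fderivWithin (hK x hx)
  change fderivWithin ℝ (G ∘ fun y => (y, t)) K x v = _
  rw [h2]
  simp [dirDeriv]

theorem derivWithin_slice_eq_dirDeriv {K : Set (Fin n → ℝ)} {J : Set ℝ}
    (hJ : UniqueDiffOn ℝ J) {D : Set ((Fin n → ℝ) × ℝ)} (hD : D = K ×ˢ J)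
    {G : (Fin n → ℝ) × ℝ → ℝ} (hG : DifferentiableOn ℝ G D)
    {x : Fin n → ℝ} {t : ℝ} (hx : x ∈ K) (ht : t ∈ J) :
    derivWithin (fun s => G (x, s)) J t = dirDeriv D G (0, 1) (x, t) := by
  subst hD
  have h := (hG (x, t) ⟨hx, ht⟩).hasFDerivWithinAt.comp (f := fun s => (x, s)) t
    ((hasFDerivAt_prodMk_right x t).hasFDerivWithinAt (s := J)) (fun y hy => ⟨hx, hy⟩)
  have h2 := h.fderivWithin (hJ t ht)
  rw [← fderivWithin_derivWithin]
  change fderivWithin ℝ (G ∘ fun y => (x, y)) J t 1 = _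
  rw [h2]
  simp [dirDeriv]

theorem prodMk_zero_eq_sum (v : Fin n → ℝ) :
    ((v, 0) : (Fin n → ℝ) × ℝ) = ∑ i, v i • ((Pi.single i 1, 0) : (Fin n → ℝ) × ℝ) := by
  refine Prod.ext ?_ ?_
  · ext j
    simp [Prod.fst_sum, Finset.sum_apply, Pi.single_apply]
  · simp [Prod.snd_sum]

theorem dirDeriv_prodMk_zero_eq_sum (D : Set ((Fin n → ℝ) × ℝ)) (w : (Fin n → ℝ) × ℝ → ℝ)
    (v : Fin n → ℝ) (z : (Fin n → ℝ) × ℝ) :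
    dirDeriv D w (v, 0) z = ∑ i, v i * dirDeriv D w (Pi.single i 1, 0) z := by
  unfold dirDeriv
  rw [prodMk_zero_eq_sum v, map_sum]
  exact Finset.sum_congr rfl fun i _ => by rw [map_smul, smul_eq_mul]

variable {γ : (Fin n → ℝ) → Fin n → ℝ} {α : (Fin n → ℝ) → ℝ} {u : (Fin n → ℝ) → ℝ → ℝ}

theorem spGrad_eq_dirDeriv (hK : UniqueDiffOn ℝ (closure Ω))
    (hu : IsGraphMCF Ω γ α (Ico 0 T) u) {x : Fin n → ℝ} {t : ℝ} (hx : x ∈ closure Ω)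
    (ht : t ∈ Ico 0 T) (i : Fin n) :
    spGrad Ω u x t i = dirDeriv (closure Ω ×ˢ Ico (0 : ℝ) T) (fun q => u q.1 q.2)
      (Pi.single i 1, 0) (x, t) :=
  fderivWithin_slice_eq_dirDeriv hK rfl (G := fun q => u q.1 q.2)
    (hu.smooth.differentiableOn (by simp)) hx ht _

theorem spGradSq_eq_dirDeriv (hK : UniqueDiffOn ℝ (closure Ω))
    (hu : IsGraphMCF Ω γ α (Ico 0 T) u) {x : Fin n → ℝ} {t : ℝ} (hx : x ∈ closure Ω)
    (ht : t ∈ Ico 0 T) :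
    spGradSq Ω u x t = ∑ i, dirDeriv (closure Ω ×ˢ Ico (0 : ℝ) T) (fun q => u q.1 q.2)
      (Pi.single i 1, 0) (x, t) ^ 2 :=
  Finset.sum_congr rfl fun i _ => by rw [spGrad_eq_dirDeriv hK hu hx ht i]

/-- The flow equation, extended to the boundary by continuity. -/
theorem dirDeriv_eq_of_isGraphMCF (hΩo : IsOpen Ω) (hΩconv : Convex ℝ Ω) (hΩne : Ω.Nonempty)
    (hT : 0 < T) (hu : IsGraphMCF Ω γ α (Ico 0 T) u) {D : Set ((Fin n → ℝ) × ℝ)}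
    (hD : D = closure Ω ×ˢ Ico (0 : ℝ) T) {F : (Fin n → ℝ) × ℝ → ℝ}
    (hFu : F = fun q => u q.1 q.2) {e : Fin n → (Fin n → ℝ) × ℝ}
    (he : e = fun i => (Pi.single i 1, 0)) {z : (Fin n → ℝ) × ℝ} (hz : z ∈ D) :
    dirDeriv D F (0, 1) z = √(1 - ∑ i, dirDeriv D F (e i) z ^ 2) *
      ∑ i, dirDeriv D (fun y => dirDeriv D F (e i) y * tilt D F e y) (e i) z := by
  have hK : UniqueDiffOn ℝ (closure Ω) := uniqueDiffOn_convex hΩconv.closure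
    (hΩne.mono (interior_maximal subset_closure hΩo))
  have hDu : UniqueDiffOn ℝ D := hD ▸ uniqueDiffOn_closure_prod_Ico hΩo hΩconv hΩne hT
  have hF : ContDiffOn ℝ ∞ F D := by rw [hD, hFu]; exact hu.smooth
  have hsp : ∀ z ∈ D, ∑ i, dirDeriv D F (e i) z ^ 2 < 1 := by
    rintro ⟨x, t⟩ hz
    rw [hD] at hz
    rw [hD, hFu, he, ← spGradSq_eq_dirDeriv hK hu hz.1 hz.2]
    exact hu.spacelike x hz.1 t hz.2
  have hQ : ∀ i, ContDiffOn ℝ ∞ (fun y => dirDeriv D F (e i) y * tilt D F e y) D :=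
    fun i => (contDiffOn_dirDeriv hDu hF (e i)).mul (contDiffOn_tilt hDu hF hsp)
  have hΩ : EqOn (dirDeriv D F (0, 1)) (fun z => √(1 - ∑ i, dirDeriv D F (e i) z ^ 2) *
      ∑ i, dirDeriv D (fun y => dirDeriv D F (e i) y * tilt D F e y) (e i) z)
      (Ω ×ˢ Ico (0 : ℝ) T) := by
    rintro ⟨x, t⟩ ⟨hx, ht⟩
    have hx' : x ∈ closure Ω := subset_closure hx
    have h := hu.pde x hx t ht
    have h1 := derivWithin_slice_eq_dirDeriv (uniqueDiffOn_Ico 0 T) hD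
      (hF.differentiableOn (by simp)) hx' ht
    simp only
    rw [← h1]
    have hsq : ∑ i, dirDeriv D F (e i) (x, t) ^ 2 = spGradSq Ω u x t := by
      rw [hD, hFu, he, ← spGradSq_eq_dirDeriv hK hu hx' ht]
    rw [hsq, hFu, h]
    congr 1
    refine Finset.sum_congr rfl fun i _ => ?_
    have h2 := fderivWithin_slice_eq_dirDeriv hK hD
      ((hQ i).differentiableOn (by simp)) hx' ht (Pi.single i 1)
    have hei : (Pi.single i 1, 0) = e i := by rw [he]
    rw [hei] at h2
    rw [← hFu, ← h2]
    have hcongr : EqOn (fun y => spGrad Ω u y t i / √(1 - spGradSq Ω u y t))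
        (fun y => dirDeriv D F (e i) (y, t) * tilt D F e (y, t)) (closure Ω) := by
      intro y hy
      simp only [tilt]
      rw [spGrad_eq_dirDeriv hK hu hy ht, spGradSq_eq_dirDeriv hK hu hy ht, hD, hFu, he,
        div_eq_mul_inv]
    rw [fderivWithin_congr hcongr (hcongr hx')]
  refine hΩ.of_subset_closure (contDiffOn_dirDeriv hDu hF _).continuousOn ?_
    (hD ▸ prod_mono_left subset_closure) ?_ hz
  · exact ((contDiffOn_sqrt_one_sub_gradSq hDu hF hsp).mul
      (ContDiffOn.sum fun i _ => contDiffOn_dirDeriv hDu (hQ i) (e i))).continuousOn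
  · rw [hD, closure_prod_eq]
    exact prod_mono_right subset_closure

/-- The time derivative of the Neumann condition: the speed satisfies a homogeneous oblique
boundary condition. -/
theorem exists_oblique_of_isGraphMCF (hΩo : IsOpen Ω) (hΩconv : Convex ℝ Ω) (hΩne : Ω.Nonempty)
    (hT : 0 < T) (hγunit : ∀ x ∈ frontier Ω, ∑ i, (γ x i) ^ 2 = 1)
    (hu : IsGraphMCF Ω γ α (Ico 0 T) u) {D : Set ((Fin n → ℝ) × ℝ)}
    (hD : D = closure Ω ×ˢ Ico (0 : ℝ) T) {F : (Fin n → ℝ) × ℝ → ℝ}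
    (hFu : F = fun q => u q.1 q.2) {x : Fin n → ℝ} (hx : x ∈ frontier Ω) {t : ℝ}
    (ht : t ∈ Ico (0 : ℝ) T) :
    ∃ β : Fin n → ℝ, 0 < ∑ i, γ x i * β i ∧
      dirDeriv D (dirDeriv D F (0, 1)) (β, 0) (x, t) = 0 := by
  have hK : UniqueDiffOn ℝ (closure Ω) := uniqueDiffOn_convex hΩconv.closure
    (hΩne.mono (interior_maximal subset_closure hΩo))
  have hDu : UniqueDiffOn ℝ D := hD ▸ uniqueDiffOn_closure_prod_Ico hΩo hΩconv hΩne hT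
  have hDi : D ⊆ closure (interior D) := hD ▸ subset_closure_interior_of_convex
    (convex_closure_prod_Ico hΩconv) (interior_closure_prod_Ico_nonempty hΩo hΩne hT)
  have hF : ContDiffOn ℝ ∞ F D := by rw [hD, hFu]; exact hu.smooth
  obtain ⟨e, he⟩ : ∃ e : Fin n → (Fin n → ℝ) × ℝ, e = fun i => (Pi.single i 1, 0) := ⟨_, rfl⟩
  have hgrad : ∀ y ∈ closure Ω, ∀ s ∈ Ico 0 T, ∀ i, spGrad Ω u y s i = dirDeriv D F (e i) (y, s) :=
    fun y hy s hs i => by rw [spGrad_eq_dirDeriv hK hu hy hs, hD, hFu, he]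
  have hgradSq : ∀ y ∈ closure Ω, ∀ s ∈ Ico 0 T,
      spGradSq Ω u y s = ∑ i, dirDeriv D F (e i) (y, s) ^ 2 :=
    fun y hy s hs => Finset.sum_congr rfl fun i _ => by rw [hgrad y hy s hs]
  have hsp : ∀ z ∈ D, ∑ i, dirDeriv D F (e i) z ^ 2 < 1 := by
    rintro ⟨y, s⟩ hz
    rw [hD] at hz
    rw [← hgradSq y hz.1 s hz.2]
    exact hu.spacelike y hz.1 s hz.2
  have hp : ∀ i, ContDiffOn ℝ ∞ (dirDeriv D F (e i)) D := fun i => contDiffOn_dirDeriv hDu hF (e i)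
  have hxK : x ∈ closure Ω := hx.1
  have hz : (x, t) ∈ D := hD ▸ ⟨hxK, ht⟩
  have hd : ∀ {f : (Fin n → ℝ) × ℝ → ℝ}, ContDiffOn ℝ ∞ f D → DifferentiableOn ℝ f D :=
    fun h => h.differentiableOn (by simp)
  have hγp : ∀ i, ContDiffOn ℝ ∞ (fun z => γ x i * dirDeriv D F (e i) z) D :=
    fun i => contDiffOn_const.mul (hp i)
  have hR := contDiffOn_sqrt_one_sub_gradSq hDu hF hsp
  have hneu : EqOn (fun s => ∑ i, γ x i * dirDeriv D F (e i) (x, s))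
      (fun s => α x * √(1 - ∑ i, dirDeriv D F (e i) (x, s) ^ 2)) (Ico 0 T) := by
    intro s hs
    have h := hu.neumann x hx s hs
    simp only
    rw [← hgradSq x hxK s hs, ← h]
    exact Finset.sum_congr rfl fun i _ => by rw [hgrad x hxK s hs]
  have hsum : ContDiffOn ℝ ∞ (fun z => ∑ i, γ x i * dirDeriv D F (e i) z) D :=
    ContDiffOn.sum fun i _ => hγp i
  have hαR : ContDiffOn ℝ ∞ (fun z => α x * √(1 - ∑ i, dirDeriv D F (e i) z ^ 2)) D :=
    contDiffOn_const.mul hR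
  have h1 := derivWithin_slice_eq_dirDeriv (uniqueDiffOn_Ico 0 T) hD (hd hsum) hxK ht
  have h2 := derivWithin_slice_eq_dirDeriv (uniqueDiffOn_Ico 0 T) hD (hd hαR) hxK ht
  rw [derivWithin_congr hneu (hneu ht), h2, dirDeriv_const_mul hDu _ _ hz (hd hR),
    dirDeriv_sqrt_one_sub_gradSq hDu hF hsp _ hz,
    dirDeriv_sum hDu _ hz fun i => hd (hγp i)] at h1
  have hcomm : ∀ k, dirDeriv D (dirDeriv D F (e k)) (0, 1) (x, t) =
      dirDeriv D (dirDeriv D F (0, 1)) (e k) (x, t) :=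
    fun k => dirDeriv_comm hDu hDi hF (e k) (0, 1) hz
  have h3 : ∀ i, dirDeriv D (fun z => γ x i * dirDeriv D F (e i) z) (0, 1) (x, t) =
      γ x i * dirDeriv D (dirDeriv D F (0, 1)) (e i) (x, t) := fun i => by
    rw [dirDeriv_const_mul hDu _ _ hz (hd (hp i)), hcomm]
  simp only [h3, hcomm] at h1
  have hRpos := Real.sqrt_pos.2 (sub_pos.2 (hsp (x, t) hz))
  have hRρ : tilt D F e (x, t) * √(1 - ∑ i, dirDeriv D F (e i) (x, t) ^ 2) = 1 :=
    inv_mul_cancel₀ hRpos.ne'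
  have hneut := hneu ht
  simp only at hneut
  refine ⟨fun i => γ x i + α x * tilt D F e (x, t) * dirDeriv D F (e i) (x, t), ?_, ?_⟩
  · have : ∑ i, γ x i * (γ x i + α x * tilt D F e (x, t) * dirDeriv D F (e i) (x, t)) =
        ∑ i, γ x i ^ 2 + α x * tilt D F e (x, t) *
          ∑ i, γ x i * dirDeriv D F (e i) (x, t) := by
      rw [Finset.mul_sum, ← Finset.sum_add_distrib]
      exact Finset.sum_congr rfl fun i _ => by ring
    rw [this, hγunit x hx, hneut]
    have h4 : α x * tilt D F e (x, t) *
        (α x * √(1 - ∑ i, dirDeriv D F (e i) (x, t) ^ 2)) = α x ^ 2 := by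
      linear_combination α x ^ 2 * hRρ
    rw [h4]
    positivity
  · rw [dirDeriv_prodMk_zero_eq_sum]
    simp only [show ∀ i, ((Pi.single i 1, 0) : (Fin n → ℝ) × ℝ) = e i from fun i => by rw [he],
      add_mul, Finset.sum_add_distrib]
    rw [← h1, Finset.mul_sum, ← Finset.sum_neg_distrib, Finset.mul_sum, ← Finset.sum_add_distrib]
    exact Finset.sum_eq_zero fun i _ => by ring

end Flow

/-- **Speed bound** (Lemma `Hest` in graphical form): for a smooth solution of
graphical spacelike mean curvature flow with `α`-Neumann boundary condition on a
compact convex smooth domain `Ω ⊂ ℝⁿ`, the speed `u_t` is bounded for all time by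
`C_H = sup_Ω |u_t(·,0)|`, a constant determined by the initial datum `u₀ = u(·,0)`
(via the equation, `u_t(·,0) = √(1-|Du₀|²) ∑ᵢ Dᵢ(Dᵢu₀/√(1-|Du₀|²))`). -/
theorem speed_bound
    {n : ℕ} (Ω : Set (Fin n → ℝ)) (hΩo : IsOpen Ω) (hΩconv : Convex ℝ Ω)
    (hΩbd : Bornology.IsBounded Ω) (hΩne : Ω.Nonempty)
    -- `γ` is the outward unit normal of the smooth boundary `∂Ω`
    (γ : (Fin n → ℝ) → Fin n → ℝ)
    (hγunit : ∀ x ∈ frontier Ω, ∑ i, (γ x i) ^ 2 = 1)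
    (hγout : ∀ x ∈ frontier Ω, ∀ y ∈ Ω, ∑ i, γ x i * (y i - x i) ≤ 0)
    (hγs : ContDiffOn ℝ (⊤ : ℕ∞) γ (frontier Ω))
    -- smooth boundary angle prescription
    (α : (Fin n → ℝ) → ℝ) (hαs : ContDiffOn ℝ (⊤ : ℕ∞) α (frontier Ω))
    -- the solution
    (T : ℝ) (hT : 0 < T)
    (u : (Fin n → ℝ) → ℝ → ℝ)
    (hu : IsGraphMCF Ω γ α (Ico 0 T) u)
    -- C_H = sup_Ω |u_t(·,0)|
    (CH : ℝ) (hCH : ∀ x ∈ Ω, |derivWithin (fun s => u x s) (Ico 0 T) 0| ≤ CH) :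
    ∀ x ∈ closure Ω, ∀ t ∈ Ico (0 : ℝ) T,
      |derivWithin (fun s => u x s) (Ico 0 T) t| ≤ CH := by
  obtain ⟨D, hD⟩ : ∃ D, D = closure Ω ×ˢ Ico (0 : ℝ) T := ⟨_, rfl⟩
  obtain ⟨F, hFu⟩ : ∃ F : (Fin n → ℝ) × ℝ → ℝ, F = fun q => u q.1 q.2 := ⟨_, rfl⟩
  obtain ⟨e, he⟩ : ∃ e : Fin n → (Fin n → ℝ) × ℝ, e = fun i => (Pi.single i 1, 0) := ⟨_, rfl⟩
  obtain ⟨w, hwF⟩ : ∃ w, w = dirDeriv D F (0, 1) := ⟨_, rfl⟩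
  have hK : UniqueDiffOn ℝ (closure Ω) := uniqueDiffOn_convex hΩconv.closure
    (hΩne.mono (interior_maximal subset_closure hΩo))
  have hDu : UniqueDiffOn ℝ D := hD ▸ uniqueDiffOn_closure_prod_Ico hΩo hΩconv hΩne hT
  have hDi : D ⊆ closure (interior D) := hD ▸ subset_closure_interior_of_convex
    (convex_closure_prod_Ico hΩconv) (interior_closure_prod_Ico_nonempty hΩo hΩne hT)
  have hF : ContDiffOn ℝ ∞ F D := by rw [hD, hFu]; exact hu.smooth
  have hw : ContDiffOn ℝ ∞ w D := hwF ▸ contDiffOn_dirDeriv hDu hF _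
  have hsp : ∀ z ∈ D, ∑ i, dirDeriv D F (e i) z ^ 2 < 1 := by
    rintro ⟨x, t⟩ hz
    rw [hD] at hz
    rw [hD, hFu, he, ← spGradSq_eq_dirDeriv hK hu hz.1 hz.2]
    exact hu.spacelike x hz.1 t hz.2
  have hwt : ∀ x ∈ closure Ω, ∀ t ∈ Ico (0 : ℝ) T,
      derivWithin (fun s => u x s) (Ico 0 T) t = w (x, t) := by
    intro x hx t ht
    rw [hwF, ← derivWithin_slice_eq_dirDeriv (uniqueDiffOn_Ico 0 T) hD
      (hF.differentiableOn (by simp)) hx ht, hFu]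
  have h0T : (0 : ℝ) ∈ Ico 0 T := ⟨le_rfl, hT⟩
  have hinit : ∀ x ∈ closure Ω, |w (x, 0)| ≤ CH := by
    have hcont : ContinuousOn (fun x => |w (x, 0)|) (closure Ω) :=
      (hw.continuousOn.comp (f := fun x => (x, (0 : ℝ))) (by fun_prop)
        (fun x hx => hD ▸ ⟨hx, h0T⟩)).abs
    intro x hx
    exact le_on_closure (fun y hy => hwt y (subset_closure hy) 0 h0T ▸ hCH y hy) hcont
      continuousOn_const hx
  have hquad : ∀ z ∈ D, ∀ p : Fin n → ℝ, dirDeriv D (dirDeriv D w (p, 0)) (p, 0) z =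
      ∑ i, ∑ k, p i * p k * dirDeriv D (dirDeriv D w (e k)) (e i) z := by
    intro z hz p
    rw [dirDeriv_prodMk_zero_eq_sum D _ p z]
    refine Finset.sum_congr rfl fun i _ => ?_
    rw [dirDeriv_congr (fun y _ => dirDeriv_prodMk_zero_eq_sum D w p y) _ hz,
      dirDeriv_sum hDu _ hz fun k => (contDiffOn_const.mul
        (contDiffOn_dirDeriv hDu hw _)).differentiableOn (by simp), Finset.mul_sum]
    refine Finset.sum_congr rfl fun k _ => ?_
    rw [dirDeriv_const_mul hDu _ _ hz ((contDiffOn_dirDeriv hDu hw _).differentiableOn (by simp)),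
      he, mul_assoc]
  have hpde : ∀ z ∈ D, (∀ v, dirDeriv D w (v, 0) z = 0) → ∃ c : ℝ, 0 ≤ c ∧ ∃ p : Fin n → ℝ,
      dirDeriv D w (0, 1) z =
        ∑ i, dirDeriv D (dirDeriv D w (Pi.single i 1, 0)) (Pi.single i 1, 0) z +
          c * dirDeriv D (dirDeriv D w (p, 0)) (p, 0) z := by
    intro z hz hcrit
    refine ⟨tilt D F e z ^ 2, sq_nonneg _, fun i => dirDeriv D F (e i) z, ?_⟩
    have h := dirDeriv_speed_eq hDu hDi hF hsp (τ := (0, 1))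
      (fun z hz => dirDeriv_eq_of_isGraphMCF hΩo hΩconv hΩne hT hu hD hFu he hz) hz
      (fun k => by rw [← hwF, he]; exact hcrit _)
    rw [← hwF] at h
    rw [hquad z hz, h, he]
  have hbd : ∀ x ∈ frontier Ω, ∀ t ∈ Ico (0 : ℝ) T, ∃ β : Fin n → ℝ, 0 < ∑ i, γ x i * β i ∧
      dirDeriv D w (β, 0) (x, t) = 0 := fun x hx t ht =>
    hwF ▸ exists_oblique_of_isGraphMCF hΩo hΩconv hΩne hT hγunit hu hD hFu hx ht
  have hneg : ∀ v, ∀ z ∈ D, dirDeriv D (fun y => -w y) v z = -dirDeriv D w v z :=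
    fun v z hz => dirDeriv_neg hDu w v hz
  have hneg2 : ∀ v v', ∀ z ∈ D, dirDeriv D (dirDeriv D (fun y => -w y) v) v' z =
      -dirDeriv D (dirDeriv D w v) v' z := fun v v' z hz => by
    rw [dirDeriv_congr (hneg v) v' hz, dirDeriv_neg hDu _ v' hz]
  have hupper := le_of_parabolic_of_oblique hΩo hΩconv hΩbd hΩne hγout hγs.continuousOn hT hD hw
    hpde hbd fun x hx => (le_abs_self _).trans (hinit x hx)
  have hlower := le_of_parabolic_of_oblique hΩo hΩconv hΩbd hΩne hγout hγs.continuousOn hT hD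
    (w := fun y => -w y) hw.neg (by
      intro z hz hcrit
      obtain ⟨c, hc, p, hp⟩ := hpde z hz fun v => by
        have h := hcrit v
        rwa [hneg _ z hz, neg_eq_zero] at h
      refine ⟨c, hc, p, ?_⟩
      simp only [hneg _ z hz, hneg2 _ _ z hz, Finset.sum_neg_distrib, hp]
      ring) (by
      intro x hx t ht
      obtain ⟨β, hβ, h⟩ := hbd x hx t ht
      exact ⟨β, hβ, by rw [hneg _ _ (hD ▸ ⟨hx.1, ht⟩), h, neg_zero]⟩)
    fun x hx => (neg_le_abs _).trans (hinit x hx)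
  intro x hx t ht
  have hz : (x, t) ∈ D := hD ▸ ⟨hx, ht⟩
  rw [hwt x hx t ht]
  exact abs_le.2 ⟨by linarith [hlower _ hz], hupper _ hz⟩
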